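/- Let f, C_I, E, g_y, D be as in the standard setup and assume D(t) > 0 on I. Fix ε₁, ε₂ ∈ ℝ and equip ℝ² with the Lie bracket [u,v] = (u¹v² − u²v¹)·(ε₁, ε₂). For y = (y¹,y²) ∈ C_I with t = arctan(y²/y¹), define η(y) = −[(4ε₁y¹ + 4ε₂y²) + 2(−ε₁y² + ε₂y¹)·f'(t)/f(t)] / [2f''(t)/f(t) − (f'(t)/f(t))² + 4] · (−y² − y¹·f'(t)/(2f(t)), y¹ − y²·f'(t)/(2f(t))). Then g_y(η(y), u) = g_y(y, [u, y]) for every u ∈ ℝ², i.e. η is the spray vector field of the corresponding left invariant conic Finsler metric. -/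

import Mathlib

open Real Set

/-- The Hessian bilinear form (fundamental form) of the energy function `E` at `y`. -/
noncomputable def hessian (E : ℝ × ℝ → ℝ) (y u v : ℝ × ℝ) : ℝ :=
  fderiv ℝ (fderiv ℝ E) y u v

/-- The energy function `E(y¹,y²) = ((y¹)² + (y²)²)·f(arctan(y²/y¹))`. -/
noncomputable def energy (f : ℝ → ℝ) (y : ℝ × ℝ) : ℝ :=
  (y.1 ^ 2 + y.2 ^ 2) * f (Real.arctan (y.2 / y.1))

/-- The open cone `C_I = {(y¹,y²) : y¹ > 0, arctan(y²/y¹) ∈ I}`. -/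
def cone (I : Set ℝ) : Set (ℝ × ℝ) :=
  {y : ℝ × ℝ | 0 < y.1 ∧ Real.arctan (y.2 / y.1) ∈ I}

/-- `D(t) = 2f(t)f''(t) − f'(t)² + 4f(t)²`. -/
noncomputable def Dfun (f : ℝ → ℝ) (t : ℝ) : ℝ :=
  2 * f t * deriv (deriv f) t - (deriv f t) ^ 2 + 4 * (f t) ^ 2

/-- The 2-dimensional Lie bracket determined by `[e₁,e₂] = ε₁e₁ + ε₂e₂`. -/
def bracket (ε₁ ε₂ : ℝ) (u v : ℝ × ℝ) : ℝ × ℝ :=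
  (u.1 * v.2 - u.2 * v.1) • ((ε₁, ε₂) : ℝ × ℝ)

/-- The explicit spray vector field formula of Lemma 3.4. -/
noncomputable def sprayFormula (ε₁ ε₂ : ℝ) (f : ℝ → ℝ) (y : ℝ × ℝ) : ℝ × ℝ :=
  (-(((4 * ε₁ * y.1 + 4 * ε₂ * y.2) +
        2 * (-ε₁ * y.2 + ε₂ * y.1) * (deriv f (Real.arctan (y.2 / y.1)) / f (Real.arctan (y.2 / y.1)))) /
      (2 * deriv (deriv f) (Real.arctan (y.2 / y.1)) / f (Real.arctan (y.2 / y.1)) -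
        (deriv f (Real.arctan (y.2 / y.1)) / f (Real.arctan (y.2 / y.1))) ^ 2 + 4))) •
    ((-y.2 - y.1 * deriv f (Real.arctan (y.2 / y.1)) / (2 * f (Real.arctan (y.2 / y.1))),
      y.1 - y.2 * deriv f (Real.arctan (y.2 / y.1)) / (2 * f (Real.arctan (y.2 / y.1)))) : ℝ × ℝ)

lemma hasFDerivAt_angle (z : ℝ × ℝ) (hz : 0 < z.1) :
    HasFDerivAt (fun y : ℝ × ℝ => Real.arctan (y.2 / y.1))
      ((-z.2 / (z.1 ^ 2 + z.2 ^ 2)) • ContinuousLinearMap.fst ℝ ℝ ℝ +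
        (z.1 / (z.1 ^ 2 + z.2 ^ 2)) • ContinuousLinearMap.snd ℝ ℝ ℝ) z := by
  have h1 : HasFDerivAt (fun y : ℝ × ℝ => y.1) (ContinuousLinearMap.fst ℝ ℝ ℝ) z := hasFDerivAt_fst
  have h2 : HasFDerivAt (fun y : ℝ × ℝ => y.2) (ContinuousLinearMap.snd ℝ ℝ ℝ) z := hasFDerivAt_snd
  have h3 := (hasDerivAt_inv hz.ne').comp_hasFDerivAt z h1
  have h4 := (Real.hasDerivAt_arctan (z.2 * z.1⁻¹)).comp_hasFDerivAt z (h2.mul h3)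
  have hp : z.1 ^ 2 + z.2 ^ 2 ≠ 0 := by positivity
  have hz' := hz.ne'
  refine HasFDerivAt.congr_fderiv (f := fun y : ℝ × ℝ => Real.arctan (y.2 / y.1)) h4 ?_
  have hq : 1 + (z.2 * z.1⁻¹) ^ 2 = (z.1 ^ 2 + z.2 ^ 2) / z.1 ^ 2 := by field_simp
  apply ContinuousLinearMap.ext
  intro v
  simp only [hq]
  simp
  field_simp

lemma hasFDerivAt_energy (f : ℝ → ℝ) (z : ℝ × ℝ) (hz : 0 < z.1)
    (hf : DifferentiableAt ℝ f (Real.arctan (z.2 / z.1))) :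
    HasFDerivAt (energy f)
      ((2 * z.1 * f (Real.arctan (z.2 / z.1)) - z.2 * deriv f (Real.arctan (z.2 / z.1))) •
          ContinuousLinearMap.fst ℝ ℝ ℝ +
        (2 * z.2 * f (Real.arctan (z.2 / z.1)) + z.1 * deriv f (Real.arctan (z.2 / z.1))) •
          ContinuousLinearMap.snd ℝ ℝ ℝ) z := by
  have h1 : HasFDerivAt (fun y : ℝ × ℝ => y.1) (ContinuousLinearMap.fst ℝ ℝ ℝ) z := hasFDerivAt_fst
  have h2 : HasFDerivAt (fun y : ℝ × ℝ => y.2) (ContinuousLinearMap.snd ℝ ℝ ℝ) z := hasFDerivAt_snd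
  have h3 := hf.hasDerivAt.comp_hasFDerivAt z (hasFDerivAt_angle z hz)
  have h4 := ((h1.pow 2).add (h2.pow 2)).mul h3
  have hp : z.1 ^ 2 + z.2 ^ 2 ≠ 0 := by positivity
  refine HasFDerivAt.congr_fderiv (f := energy f) h4 ?_
  apply ContinuousLinearMap.ext
  intro v
  simp
  field_simp
  ring

lemma hessian_energy (I : Set ℝ) (hIopen : IsOpen I) (f : ℝ → ℝ)
    (hf : ContDiffOn ℝ (⊤ : ℕ∞) f I) (y : ℝ × ℝ) (hy : y ∈ cone I) (u v : ℝ × ℝ) (a b c : ℝ)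
    (ha : a = f (Real.arctan (y.2 / y.1))) (hb : b = deriv f (Real.arctan (y.2 / y.1)))
    (hc : c = deriv (deriv f) (Real.arctan (y.2 / y.1))) :
    hessian (energy f) y u v =
      (2 * a * u.1 - b * u.2 + (2 * y.1 * b - y.2 * c) *
        ((-y.2 * u.1 + y.1 * u.2) / (y.1 ^ 2 + y.2 ^ 2))) * v.1 +
      (2 * a * u.2 + b * u.1 + (2 * y.2 * b + y.1 * c) *
        ((-y.2 * u.1 + y.1 * u.2) / (y.1 ^ 2 + y.2 ^ 2))) * v.2 := by
  obtain ⟨hy1, hyI⟩ := hy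
  have hd : ∀ t ∈ I, DifferentiableAt ℝ f t := fun t ht =>
    (hf.differentiableOn (by simp)).differentiableAt (hIopen.mem_nhds ht)
  have hd2 : DifferentiableAt ℝ (deriv f) (Real.arctan (y.2 / y.1)) :=
    ((hf.deriv_of_isOpen (m := 1) hIopen (WithTop.coe_le_coe.2 (le_top : (1 + 1 : ℕ∞) ≤ ⊤))).differentiableOn
      (by simp)).differentiableAt (hIopen.mem_nhds hyI)
  have hev : fderiv ℝ (energy f) =ᶠ[nhds y] fun z =>
      ((2 * z.1 * f (Real.arctan (z.2 / z.1)) - z.2 * deriv f (Real.arctan (z.2 / z.1))) •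
          ContinuousLinearMap.fst ℝ ℝ ℝ +
        (2 * z.2 * f (Real.arctan (z.2 / z.1)) + z.1 * deriv f (Real.arctan (z.2 / z.1))) •
          ContinuousLinearMap.snd ℝ ℝ ℝ) := by
    have e1 : ∀ᶠ z : ℝ × ℝ in nhds y, 0 < z.1 :=
      continuous_fst.continuousAt.eventually (lt_mem_nhds hy1)
    have e2 : ∀ᶠ z : ℝ × ℝ in nhds y, Real.arctan (z.2 / z.1) ∈ I :=
      (hasFDerivAt_angle y hy1).continuousAt.eventually (hIopen.mem_nhds hyI)
    filter_upwards [e1, e2] with z h1 h2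
    exact (hasFDerivAt_energy f z h1 (hd _ h2)).fderiv
  have h1 : HasFDerivAt (fun y : ℝ × ℝ => y.1) (ContinuousLinearMap.fst ℝ ℝ ℝ) y := hasFDerivAt_fst
  have h2 : HasFDerivAt (fun y : ℝ × ℝ => y.2) (ContinuousLinearMap.snd ℝ ℝ ℝ) y := hasFDerivAt_snd
  have k0 := (hd _ hyI).hasDerivAt.comp_hasFDerivAt y (hasFDerivAt_angle y hy1)
  have k1 := hd2.hasDerivAt.comp_hasFDerivAt y (hasFDerivAt_angle y hy1)
  have A := ((h1.const_mul 2).mul k0).sub (h2.mul k1)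
  have B := ((h2.const_mul 2).mul k0).add (h1.mul k1)
  have H := (A.smul_const (ContinuousLinearMap.fst ℝ ℝ ℝ)).add
    (B.smul_const (ContinuousLinearMap.snd ℝ ℝ ℝ))
  have H' := (H.congr_of_eventuallyEq hev).fderiv
  unfold hessian
  rw [H']
  have hp : y.1 ^ 2 + y.2 ^ 2 ≠ 0 := by positivity
  simp [← ha, ← hb, ← hc]
  field_simp
  ring

theorem spray_vector_field_formula
    (I : Set ℝ) (hIopen : IsOpen I) (hIsub : I ⊆ Ioo (-(π / 2)) (π / 2))
    (hI0 : (0 : ℝ) ∈ I)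
    (f : ℝ → ℝ) (hf : ContDiffOn ℝ (⊤ : ℕ∞) f I) (hfpos : ∀ t ∈ I, 0 < f t)
    (hD : ∀ t ∈ I, 0 < Dfun f t)
    (ε₁ ε₂ : ℝ) :
    ∀ y ∈ cone I, ∀ u : ℝ × ℝ,
      hessian (energy f) y (sprayFormula ε₁ ε₂ f y) u =
        hessian (energy f) y y (bracket ε₁ ε₂ u y) := by
  intro y hy u
  obtain ⟨a, ha⟩ : ∃ a, a = f (Real.arctan (y.2 / y.1)) := ⟨_, rfl⟩
  obtain ⟨b, hb⟩ : ∃ b, b = deriv f (Real.arctan (y.2 / y.1)) := ⟨_, rfl⟩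
  obtain ⟨c, hc⟩ : ∃ c, c = deriv (deriv f) (Real.arctan (y.2 / y.1)) := ⟨_, rfl⟩
  rw [hessian_energy I hIopen f hf y hy _ _ a b c ha hb hc,
    hessian_energy I hIopen f hf y hy _ _ a b c ha hb hc]
  have hapos : 0 < a := ha ▸ hfpos _ hy.2
  have hDpos := hD _ hy.2
  have hy1 := hy.1
  unfold Dfun at hDpos
  unfold sprayFormula bracket
  rw [← ha, ← hb, ← hc] at hDpos ⊢
  obtain ⟨y1, y2⟩ := y
  obtain ⟨u1, u2⟩ := u
  simp only [Prod.smul_mk, smul_eq_mul] at *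
  clear ha hb hc
  have hp : y1 ^ 2 + y2 ^ 2 ≠ 0 := by positivity
  have hden : 2 * c / a - (b / a) ^ 2 + 4 = (2 * a * c - b ^ 2 + 4 * a ^ 2) / a ^ 2 := by
    field_simp
  rw [hden]
  obtain ⟨D, hDd⟩ : ∃ D, D = 2 * a * c - b ^ 2 + 4 * a ^ 2 := ⟨_, rfl⟩
  rw [← hDd] at hDpos ⊢
  have hD0 := hDpos.ne'
  clear hden
  have hc' : c = (D + b ^ 2 - 4 * a ^ 2) / (2 * a) := by
    field_simp
    linarith
  subst hc'
  field_simp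
  ring
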